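/- arXiv:2003.01595 — 4 statements merged into one kernel-verified Lean document; each statement's English description precedes it below -/
import Mathlib

section
/- Let S be a finite set of points in ℝ^d, n : ℝ^d → ℝ a nonnegative function, and Y a finite label set with |Y| ≥ 2. If for every x ∈ S one has n(0) > Σ_{x' ∈ S, x' ≠ x} n(x − x'), then every labeling f : S → Y is realized by noise augmentation: for every x ∈ S and every label y ∈ Y with y ≠ f(x), Σ_{x' ∈ S, f(x') = f(x)} n(x − x') > Σ_{x' ∈ S, f(x') = y} n(x − x'), so f(x) is the unique label of maximum score at x. -/
/-- Multiclass form of part (ii) of the threshold theorem: if every sample's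
self-influence `n 0` strictly dominates the total influence of the other samples,
then every labeling `f : S → Y` is realized by noise augmentation: at every `x ∈ S`,
the score of `f x` strictly exceeds the score of every other label `y`. -/
theorem stmt_3 {d : ℕ} {Y : Type*} [Fintype Y] [DecidableEq Y]
    (hY : 2 ≤ Fintype.card Y)
    (S : Finset (Fin d → ℝ)) (n : (Fin d → ℝ) → ℝ)
    (hn : ∀ z, 0 ≤ n z)
    (hdom : ∀ x ∈ S, n 0 > ∑ x' ∈ S.erase x, n (x - x')) :
    ∀ f : (Fin d → ℝ) → Y, ∀ x ∈ S, ∀ y : Y, y ≠ f x →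
      ∑ x' ∈ S.filter (fun x' => f x' = f x), n (x - x') >
      ∑ x' ∈ S.filter (fun x' => f x' = y), n (x - x') := by
  intro f x hx y hy
  calc ∑ x' ∈ S.filter (fun x' => f x' = y), n (x - x')
      ≤ ∑ x' ∈ S.erase x, n (x - x') := by
        refine Finset.sum_le_sum_of_subset_of_nonneg (fun z hz => ?_) fun z _ _ => hn _
        obtain ⟨hzS, hzy⟩ := Finset.mem_filter.mp hz
        refine Finset.mem_erase.mpr ⟨?_, hzS⟩
        rintro rfl
        exact hy hzy.symm
    _ < n (x - x) := by simpa using hdom x hx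
    _ ≤ ∑ x' ∈ S.filter (fun x' => f x' = f x), n (x - x') :=
        Finset.single_le_sum (f := fun x' => n (x - x')) (fun z _ => hn _)
          (Finset.mem_filter.mpr ⟨hx, rfl⟩)
end

section
/- Let ψ : ℝ → ℝ be even, continuous, strictly increasing on [0,∞), with ψ(0) = 0 and ψ(t) → ∞ as t → ∞. Let S ⊂ ℝ^d be a set of N ≥ 3 pairwise distinct points, and for σ > 0 define n_σ(z) = exp(−Σ_{i=1}^d ψ(z_i/σ)). Then there exists a real number θ > 0 such that: (i) for every σ ∈ (0, θ), for all x ∈ S, n_σ(0) > Σ_{x' ∈ S, x' ≠ x} n_σ(x − x'), and hence every labeling h : S → {−1,+1} is realized by noise augmentation with density n_σ; (ii) for every σ > θ, there exists x ∈ S with n_σ(0) < Σ_{x' ∈ S, x' ≠ x} n_σ(x − x'), and hence some labeling of S is not realized by noise augmentation with density n_σ. Moreover θ = sup{σ > 0 : for all x ∈ S, n_σ(0) ≥ Σ_{x' ≠ x} n_σ(x − x')}. -/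
open Filter Topology

section Kernel

variable {d : ℕ} {ψ : ℝ → ℝ}

/-- The noise density `exp (-∑ i, ψ (z i / σ))` with shape `ψ` and dispersion `σ`. -/
noncomputable def noiseDensity (ψ : ℝ → ℝ) (σ : ℝ) (z : Fin d → ℝ) : ℝ :=
  Real.exp (-∑ i, ψ (z i / σ))

lemma noiseDensity_pos (σ : ℝ) (z : Fin d → ℝ) : 0 < noiseDensity ψ σ z :=
  Real.exp_pos _

lemma noiseDensity_zero (hψ0 : ψ 0 = 0) (σ : ℝ) :
    noiseDensity ψ σ (0 : Fin d → ℝ) = 1 := by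
  simp [noiseDensity, hψ0]

lemma apply_abs_of_even (heven : ∀ t, ψ (-t) = ψ t) (t : ℝ) : ψ |t| = ψ t := by
  rcases abs_choice t with h | h <;> rw [h]
  exact heven t

lemma nonneg_of_even_of_strictMonoOn (heven : ∀ t, ψ (-t) = ψ t)
    (hmono : StrictMonoOn ψ (Set.Ici 0)) (hψ0 : ψ 0 = 0) (t : ℝ) : 0 ≤ ψ t := by
  rw [← apply_abs_of_even heven, ← hψ0]
  exact hmono.monotoneOn Set.self_mem_Ici (abs_nonneg t) (abs_nonneg t)

lemma div_lt_div_apply_of_even (heven : ∀ t, ψ (-t) = ψ t)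
    (hmono : StrictMonoOn ψ (Set.Ici 0)) {a σ τ : ℝ} (ha : a ≠ 0) (hσ : 0 < σ) (h : σ < τ) :
    ψ (a / τ) < ψ (a / σ) := by
  rw [← apply_abs_of_even heven (a / τ), ← apply_abs_of_even heven (a / σ)]
  refine hmono (Set.mem_Ici.2 (abs_nonneg _)) (Set.mem_Ici.2 (abs_nonneg _)) ?_
  rw [abs_div, abs_div, abs_of_pos hσ, abs_of_pos (hσ.trans h)]
  exact div_lt_div_of_pos_left (abs_pos.2 ha) hσ h

lemma noiseDensity_lt_noiseDensity (heven : ∀ t, ψ (-t) = ψ t)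
    (hmono : StrictMonoOn ψ (Set.Ici 0)) {z : Fin d → ℝ} (hz : z ≠ 0) {σ τ : ℝ}
    (hσ : 0 < σ) (h : σ < τ) : noiseDensity ψ σ z < noiseDensity ψ τ z := by
  obtain ⟨j, hj⟩ := Function.ne_iff.1 hz
  refine Real.exp_lt_exp.2 (neg_lt_neg (Finset.sum_lt_sum (fun i _ => ?_)
    ⟨j, Finset.mem_univ j, div_lt_div_apply_of_even heven hmono hj hσ h⟩))
  by_cases hi : z i = 0
  · simp [hi]
  · exact (div_lt_div_apply_of_even heven hmono hi hσ h).le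

lemma tendsto_noiseDensity_nhdsGT_zero (heven : ∀ t, ψ (-t) = ψ t)
    (hmono : StrictMonoOn ψ (Set.Ici 0)) (hψ0 : ψ 0 = 0) (htop : Tendsto ψ atTop atTop)
    {z : Fin d → ℝ} (hz : z ≠ 0) :
    Tendsto (fun σ => noiseDensity ψ σ z) (𝓝[>] 0) (𝓝 0) := by
  obtain ⟨j, hj⟩ := Function.ne_iff.1 hz
  refine Real.tendsto_exp_neg_atTop_nhds_zero.comp ?_
  have hdiv : Tendsto (fun σ : ℝ => |z j| * σ⁻¹) (𝓝[>] 0) atTop :=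
    tendsto_inv_nhdsGT_zero.const_mul_atTop (abs_pos.2 hj)
  refine tendsto_atTop_mono' _ ?_ (htop.comp hdiv)
  filter_upwards [self_mem_nhdsWithin] with σ hσ
  have hσ' : |z j| * σ⁻¹ = |z j / σ| := by
    rw [abs_div, abs_of_pos (Set.mem_Ioi.1 hσ), div_eq_mul_inv]
  rw [Function.comp_apply, hσ', apply_abs_of_even heven]
  exact Finset.single_le_sum (f := fun i => ψ (z i / σ))
    (fun i _ => nonneg_of_even_of_strictMonoOn heven hmono hψ0 _) (Finset.mem_univ j)

lemma tendsto_noiseDensity_atTop (hcont : Continuous ψ) (hψ0 : ψ 0 = 0) (z : Fin d → ℝ) :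
    Tendsto (fun σ => noiseDensity ψ σ z) atTop (𝓝 1) := by
  have hsum : Tendsto (fun σ : ℝ => ∑ i, ψ (z i / σ)) atTop (𝓝 (∑ _i : Fin d, ψ 0)) :=
    tendsto_finsetSum _ fun i _ =>
      (hcont.tendsto 0).comp (tendsto_const_nhds.div_atTop tendsto_id)
  simpa [hψ0, noiseDensity, Function.comp_def] using (Real.continuous_exp.tendsto _).comp hsum.neg

end Kernel

section Labeling

variable {α : Type*} [DecidableEq α] {S : Finset α} {x : α}

lemma label_mul_sum_pos {k h : α → ℝ} (hx : x ∈ S) (hk : ∀ y ∈ S, 0 ≤ k y)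
    (hdom : ∑ y ∈ S.erase x, k y < k x) (hh : ∀ y ∈ S, h y = 1 ∨ h y = -1) :
    0 < h x * ∑ y ∈ S, h y * k y := by
  have hlow : -∑ y ∈ S.erase x, k y ≤ ∑ y ∈ S.erase x, h x * (h y * k y) := by
    rw [← Finset.sum_neg_distrib]
    refine Finset.sum_le_sum fun y hy => ?_
    have hy' := Finset.mem_of_mem_erase hy
    have := hk y hy'
    rcases hh x hx with h1 | h1 <;> rcases hh y hy' with h2 | h2 <;> rw [h1, h2] <;> linarith
  have hself : h x * (h x * k x) = k x := by
    rcases hh x hx with h1 | h1 <;> rw [h1] <;> ring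
  rw [Finset.mul_sum, ← Finset.add_sum_erase S _ hx, hself]
  linarith

lemma exists_label_mul_sum_neg {k : α → ℝ} (hx : x ∈ S)
    (hdom : k x < ∑ y ∈ S.erase x, k y) :
    ∃ h : α → ℝ, (∀ y, h y = 1 ∨ h y = -1) ∧ h x * ∑ y ∈ S, h y * k y < 0 := by
  refine ⟨fun y => if y = x then 1 else -1, fun y => ?_, ?_⟩
  · by_cases h : y = x <;> simp [h]
  · have hsum : ∑ y ∈ S.erase x, (if y = x then (1 : ℝ) else -1) * k y
        = -∑ y ∈ S.erase x, k y := by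
      rw [← Finset.sum_neg_distrib]
      refine Finset.sum_congr rfl fun y hy => ?_
      simp [Finset.ne_of_mem_erase hy]
    rw [← Finset.add_sum_erase S _ hx, hsum]
    simp only [if_true]
    linarith

end Labeling


/-- The paper's main threshold theorem (Theorem 3) for the noise shape
`n_σ z = exp (-∑ i, ψ (z i / σ))`: for `ψ` even, continuous, strictly increasing on
`[0,∞)`, with `ψ 0 = 0` and `ψ → ∞`, and a training set `S` of at least 3 (pairwise
distinct) points, there is a critical threshold `θ > 0` such that
(i) below `θ` every sample's self-influence strictly dominates the rest and every `±1`
labeling of `S` is realized by noise augmentation, and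
(ii) above `θ` some sample's self-influence is strictly dominated and some labeling of
`S` is not realized; moreover `θ` is the supremum of the feasible dispersions. -/
theorem stmt_7 {d : ℕ} (ψ : ℝ → ℝ)
    (heven : ∀ t, ψ (-t) = ψ t)
    (hcont : Continuous ψ)
    (hmono : StrictMonoOn ψ (Set.Ici 0))
    (hψ0 : ψ 0 = 0)
    (htop : Filter.Tendsto ψ Filter.atTop Filter.atTop)
    (S : Finset (Fin d → ℝ)) (hcard : 3 ≤ S.card) :
    ∃ θ : ℝ, 0 < θ ∧
      (∀ σ : ℝ, 0 < σ → σ < θ →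
        (∀ x ∈ S,
          Real.exp (-∑ i : Fin d, ψ ((0 : ℝ) / σ)) >
            ∑ x' ∈ S.erase x, Real.exp (-∑ i, ψ ((x i - x' i) / σ))) ∧
        (∀ h : (Fin d → ℝ) → ℝ, (∀ x ∈ S, h x = 1 ∨ h x = -1) →
          ∀ x ∈ S,
            h x * ∑ x' ∈ S, h x' * Real.exp (-∑ i, ψ ((x i - x' i) / σ)) > 0)) ∧
      (∀ σ : ℝ, θ < σ →
        (∃ x ∈ S,
          Real.exp (-∑ i : Fin d, ψ ((0 : ℝ) / σ)) <
            ∑ x' ∈ S.erase x, Real.exp (-∑ i, ψ ((x i - x' i) / σ))) ∧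
        (∃ h : (Fin d → ℝ) → ℝ, (∀ x ∈ S, h x = 1 ∨ h x = -1) ∧
          ¬ ∀ x ∈ S,
            h x * ∑ x' ∈ S, h x' * Real.exp (-∑ i, ψ ((x i - x' i) / σ)) > 0)) ∧
      θ = sSup {σ : ℝ | 0 < σ ∧ ∀ x ∈ S,
          Real.exp (-∑ i : Fin d, ψ ((0 : ℝ) / σ)) ≥
            ∑ x' ∈ S.erase x, Real.exp (-∑ i, ψ ((x i - x' i) / σ))} := by
  set F : ℝ → (Fin d → ℝ) → ℝ :=
    fun σ x => ∑ x' ∈ S.erase x, noiseDensity ψ σ (x - x')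
  have hzero : ∀ σ : ℝ, Real.exp (-∑ i : Fin d, ψ ((0 : ℝ) / σ)) = 1 :=
    fun σ => noiseDensity_zero hψ0 σ
  have hsum : ∀ σ x, ∑ x' ∈ S.erase x, Real.exp (-∑ i, ψ ((x i - x' i) / σ)) = F σ x :=
    fun _ _ => rfl
  have hself : ∀ (σ : ℝ) (x : Fin d → ℝ), noiseDensity ψ σ (x - x) = 1 := fun σ x => by
    rw [sub_self, noiseDensity_zero hψ0]
  have hker : ∀ (σ : ℝ) (x x' : Fin d → ℝ),
      Real.exp (-∑ i, ψ ((x i - x' i) / σ)) = noiseDensity ψ σ (x - x') := fun _ _ _ => rfl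
  simp only [hzero, hsum]
  simp only [hker]
  set A : Set ℝ := {σ : ℝ | 0 < σ ∧ ∀ x ∈ S, 1 ≥ F σ x}
  have hne : ∀ x, ∀ x' ∈ S.erase x, x - x' ≠ 0 := fun x x' hx' =>
    sub_ne_zero.2 (Finset.ne_of_mem_erase hx').symm
  have hFmono : ∀ x ∈ S, ∀ σ τ : ℝ, 0 < σ → σ < τ → F σ x < F τ x := by
    intro x hx σ τ hσ h
    refine Finset.sum_lt_sum_of_nonempty ?_ fun x' hx' =>
      noiseDensity_lt_noiseDensity heven hmono (hne x x' hx') hσ h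
    rw [← Finset.card_pos, Finset.card_erase_of_mem hx]
    omega
  have hApos : ∃ σ, σ ∈ A := by
    have hev : ∀ᶠ σ : ℝ in 𝓝[>] 0, ∀ x ∈ S, F σ x < 1 := by
      refine (Finset.eventually_all S).2 fun x _ => ?_
      have hlim : Tendsto (fun σ => F σ x) (𝓝[>] 0) (𝓝 (∑ _x' ∈ S.erase x, 0)) :=
        tendsto_finsetSum _ fun x' hx' =>
          tendsto_noiseDensity_nhdsGT_zero heven hmono hψ0 htop (hne x x' hx')
      rw [Finset.sum_const_zero] at hlim
      exact hlim.eventually_lt_const one_pos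
    obtain ⟨σ, hσ, hpos⟩ := (hev.and self_mem_nhdsWithin).exists
    exact ⟨σ, hpos, fun x hx => (hσ x hx).le⟩
  have hAbdd : BddAbove A := by
    obtain ⟨x, hx⟩ : S.Nonempty := Finset.card_pos.1 (by omega)
    have hlim : Tendsto (fun σ => F σ x) atTop (𝓝 (∑ _x' ∈ S.erase x, 1)) :=
      tendsto_finsetSum _ fun x' _ => tendsto_noiseDensity_atTop hcont hψ0 _
    have hgt : (1 : ℝ) < ∑ _x' ∈ S.erase x, 1 := by
      rw [Finset.sum_const, Finset.card_erase_of_mem hx, nsmul_eq_mul, mul_one]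
      exact_mod_cast (by omega : 1 < S.card - 1)
    obtain ⟨M, hM⟩ := eventually_atTop.1 (hlim.eventually_const_lt hgt)
    refine ⟨M, fun σ hσ => ?_⟩
    by_contra! hlt
    exact (hM σ hlt.le).not_ge (hσ.2 x hx)
  obtain ⟨σ₀, hσ₀⟩ := hApos
  have hpos : 0 < sSup A := hσ₀.1.trans_le (le_csSup hAbdd hσ₀)
  refine ⟨sSup A, hpos, fun σ hσ hlt => ?_, fun σ hlt => ?_, rfl⟩
  · have hdom : ∀ x ∈ S, F σ x < 1 := by
      obtain ⟨τ, hτ, hστ⟩ := exists_lt_of_lt_csSup ⟨σ₀, hσ₀⟩ hlt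
      exact fun x hx => (hFmono x hx σ τ hσ hστ).trans_le (hτ.2 x hx)
    refine ⟨hdom, fun h hh x hx => label_mul_sum_pos hx
      (k := fun x' => noiseDensity ψ σ (x - x')) (fun _ _ => (noiseDensity_pos _ _).le) ?_ hh⟩
    rw [hself]
    exact hdom x hx
  · obtain ⟨x, hx, hdom⟩ : ∃ x ∈ S, 1 < F σ x := by
      by_contra! hle
      exact hlt.not_ge (le_csSup hAbdd ⟨hpos.trans hlt, hle⟩)
    obtain ⟨h, hh, hneg⟩ := exists_label_mul_sum_neg hx
      (k := fun x' => noiseDensity ψ σ (x - x')) (by rw [hself]; exact hdom)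
    exact ⟨⟨x, hx, hdom⟩, h, fun y _ => hh y, fun hall => (hall x hx).not_gt hneg⟩
end

section
/- Let X be a finite set, and let N be a positive integer with N < |X|/2. Let A be any learning algorithm for binary classification, i.e., any function mapping training sequences of length N in (X × {0,1})^N to hypotheses X → {0,1}. Then there exists a probability distribution D over X × {0,1} such that: (1) there exists a function f : X → {0,1} with L_D(f) = 0, and (2) with probability at least 1/7 over the choice of an i.i.d. training sequence S of N pairs drawn from D, one has L_D(A(S)) ≥ 1/8. -/
open MeasureTheory
open scoped ENNReal

namespace NoFreeLunch

/-- If `h` does not depend on the value of its argument at `x`, then exactly half of the Boolean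
functions disagree with `h` at `x`. -/
lemma two_mul_card_ne_of_update_eq {X : Type*} [Fintype X] [DecidableEq X] (x : X)
    (h : (X → Bool) → Bool) (hh : ∀ f b, h (Function.update f x b) = h f) :
    2 * (Finset.univ.filter fun f : X → Bool => h f ≠ f x).card = Fintype.card (X → Bool) := by
  have hc : (Finset.univ.filter fun f : X → Bool => h f ≠ f x).card
      = (Finset.univ.filter fun f : X → Bool => ¬ h f ≠ f x).card := by
    refine Finset.card_bij' (fun f _ => Function.update f x (!f x))
      (fun f _ => Function.update f x (!f x)) ?_ ?_ ?_ ?_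
    · intro f hf
      simp only [Finset.mem_filter, Finset.mem_univ, true_and, hh, Function.update_self] at hf ⊢
      revert hf
      cases h f <;> cases f x <;> simp
    · intro f hf
      simp only [Finset.mem_filter, Finset.mem_univ, true_and, hh, Function.update_self] at hf ⊢
      revert hf
      cases h f <;> cases f x <;> simp
    · intro f _
      simp
    · intro f _
      simp
  have := Finset.card_filter_add_card_filter_not (s := Finset.univ)
    (fun f : X → Bool => h f ≠ f x)
  rw [Finset.card_univ] at this
  omega

/-- The training sequence with instances `g`, labelled by `f`. -/
def sample {X : Type*} {N : ℕ} (f : X → Bool) (g : Fin N → X) : Fin N → X × Bool :=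
  fun i => (g i, f (g i))

/-- The number of points misclassified by the hypothesis learned from `sample f g`. -/
def errorCount {X : Type*} [Fintype X] {N : ℕ} (A : (Fin N → X × Bool) → (X → Bool))
    (f : X → Bool) (g : Fin N → X) : ℕ :=
  (Finset.univ.filter fun x => A (sample f g) x ≠ f x).card

lemma card_mul_le_sum_errorCount {X : Type*} [Fintype X] [DecidableEq X] {N : ℕ}
    (A : (Fin N → X × Bool) → (X → Bool)) (g : Fin N → X) :
    Fintype.card (X → Bool) * (Fintype.card X - N) ≤ 2 * ∑ f, errorCount A f g := by
  have h₁ : ∑ f, errorCount A f g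
      = ∑ x, (Finset.univ.filter fun f : X → Bool => A (sample f g) x ≠ f x).card := by
    simp only [errorCount, Finset.card_filter]
    exact Finset.sum_comm
  set U : Finset X := (Finset.univ.image g)ᶜ
  have hU : Fintype.card X - N ≤ U.card := by
    rw [Finset.card_compl]
    have : (Finset.univ.image g).card ≤ N := by
      simpa using Finset.card_image_le (s := Finset.univ) (f := g)
    omega
  rw [h₁, Finset.mul_sum]
  calc Fintype.card (X → Bool) * (Fintype.card X - N)
      ≤ Fintype.card (X → Bool) * U.card := Nat.mul_le_mul_left _ hU
    _ = ∑ x ∈ U, 2 * (Finset.univ.filter fun f : X → Bool => A (sample f g) x ≠ f x).card := by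
        rw [mul_comm, ← smul_eq_mul, ← Finset.sum_const]
        refine Finset.sum_congr rfl fun x hx => ?_
        refine (two_mul_card_ne_of_update_eq x (fun f => A (sample f g) x) fun f b => ?_).symm
        have hg : ∀ i, g i ≠ x := by simpa [U] using hx
        have : sample (Function.update f x b) g = sample f g := by
          funext i
          simp [sample, Function.update_of_ne (hg i)]
        rw [this]
    _ ≤ _ := Finset.sum_le_sum_of_subset (Finset.subset_univ U)

/-- Some labelling has average error at least one quarter. -/
lemma exists_le_sum_errorCount {X : Type*} [Fintype X] {N : ℕ}
    (hNX : 2 * N < Fintype.card X) (A : (Fin N → X × Bool) → (X → Bool)) :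
    ∃ f : X → Bool, Fintype.card X ^ N * Fintype.card X ≤ 4 * ∑ g, errorCount A f g := by
  classical
  have hle : ∑ _f : X → Bool, Fintype.card X ^ N * Fintype.card X
      ≤ ∑ f : X → Bool, 4 * ∑ g, errorCount A f g := by
    calc ∑ _f : X → Bool, Fintype.card X ^ N * Fintype.card X
        = ∑ _g : Fin N → X, Fintype.card (X → Bool) * Fintype.card X := by
          simp only [Finset.sum_const, Finset.card_univ, smul_eq_mul, Fintype.card_fun,
            Fintype.card_fin]
          ring
      _ ≤ ∑ g : Fin N → X, 4 * ∑ f, errorCount A f g := by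
          refine Finset.sum_le_sum fun g _ => ?_
          have h := card_mul_le_sum_errorCount A g
          have h' : Fintype.card X ≤ 2 * (Fintype.card X - N) := by omega
          nlinarith [Nat.mul_le_mul_left (Fintype.card (X → Bool)) h']
      _ = _ := by
          simp only [← Finset.mul_sum]
          rw [Finset.sum_comm]
  obtain ⟨f, -, hf⟩ := Finset.exists_le_of_sum_le Finset.univ_nonempty hle
  exact ⟨f, hf⟩

/-- Some labelling makes at least a seventh of the samples yield error at least one eighth. -/
lemma exists_le_card_errorCount {X : Type*} [Fintype X] {N : ℕ}
    (hNX : 2 * N < Fintype.card X) (A : (Fin N → X × Bool) → (X → Bool)) :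
    ∃ f : X → Bool, Fintype.card X ^ N ≤
      7 * (Finset.univ.filter fun g => Fintype.card X ≤ 8 * errorCount A f g).card := by
  obtain ⟨f, hf⟩ := exists_le_sum_errorCount hNX A
  refine ⟨f, ?_⟩
  set m := Fintype.card X
  have hm : 0 < m := by omega
  have hsum : ∑ g, 8 * errorCount A f g
      ≤ ∑ g : Fin N → X, (m + if m ≤ 8 * errorCount A f g then 7 * m else 0) := by
    refine Finset.sum_le_sum fun g _ => ?_
    have : errorCount A f g ≤ m := Finset.card_le_univ _
    split_ifs <;> omega
  rw [← Finset.mul_sum, Finset.sum_add_distrib, ← Finset.sum_filter] at hsum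
  simp only [Finset.sum_const, Finset.card_univ, smul_eq_mul, Fintype.card_fun,
    Fintype.card_fin] at hsum
  refine Nat.le_of_mul_le_mul_right ?_ hm
  change _ ≤ m ^ N * m + _ at hsum
  nlinarith

/-- The distribution of `(x, f x)` for `x` uniform on `X`. -/
noncomputable def graphMeasure {X : Type*} [Fintype X] [MeasurableSpace X] (f : X → Bool) :
    Measure (X × Bool) :=
  (Fintype.card X : ℝ≥0∞)⁻¹ • ∑ x, Measure.dirac (x, f x)

section

variable {X : Type*} [Fintype X] [MeasurableSpace X] [MeasurableSingletonClass X]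

lemma graphMeasure_apply (f : X → Bool) (p : X × Bool → Prop) [DecidablePred p] :
    graphMeasure f {z | p z} =
      (Fintype.card X : ℝ≥0∞)⁻¹ * (Finset.univ.filter fun x => p (x, f x)).card := by
  simp [graphMeasure, Set.indicator_apply, Finset.sum_boole]

lemma isProbabilityMeasure_graphMeasure [Nonempty X] (f : X → Bool) :
    IsProbabilityMeasure (graphMeasure f) := by
  refine ⟨?_⟩
  have := graphMeasure_apply f fun _ => True
  simp only [Set.ofPred_true, Finset.filter_true, Finset.card_univ] at this
  rw [this, ENNReal.inv_mul_cancel (by simp) (by simp)]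

lemma graphMeasure_singleton (f : X → Bool) (x : X) :
    graphMeasure f {(x, f x)} = (Fintype.card X : ℝ≥0∞)⁻¹ := by
  classical
  have := graphMeasure_apply f fun z => z = (x, f x)
  rw [Set.ofPred_eq_eq_singleton] at this
  rw [this, Finset.card_eq_one.2 ⟨x, by ext y; simp; rintro rfl; rfl⟩]
  simp

lemma le_pi_graphMeasure [Nonempty X] {N : ℕ} (f : X → Bool) (T : Set (Fin N → X × Bool))
    (G : Finset (Fin N → X)) (hG : ∀ g ∈ G, sample f g ∈ T) :
    (G.card : ℝ≥0∞) * ((Fintype.card X : ℝ≥0∞)⁻¹) ^ N ≤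
      (Measure.pi fun _ : Fin N => graphMeasure f) T := by
  classical
  have := isProbabilityMeasure_graphMeasure f
  have hinj : Function.Injective (sample f : (Fin N → X) → _) := fun g g' h => by
    funext i
    exact congrArg Prod.fst (congrFun h i)
  calc (G.card : ℝ≥0∞) * ((Fintype.card X : ℝ≥0∞)⁻¹) ^ N
      = ∑ s ∈ G.image (sample f), (Measure.pi fun _ : Fin N => graphMeasure f) {s} := by
        rw [Finset.sum_image hinj.injOn]
        simp [Measure.pi_singleton, sample, graphMeasure_singleton]
    _ = (Measure.pi fun _ : Fin N => graphMeasure f) (G.image (sample f)) :=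
        sum_measure_singleton
    _ ≤ _ := by
        refine measure_mono fun s hs => ?_
        obtain ⟨g, hg, rfl⟩ := Finset.mem_image.1 (Finset.mem_coe.1 hs)
        exact hG g hg

end

end NoFreeLunch

open NoFreeLunch in
/-- The No-Free-Lunch theorem (the paper's Theorem 1) for binary classification with the
0–1 loss: for a finite domain `X` and any learning algorithm `A` taking training
sequences of length `N < |X|/2`, there is a probability distribution `D` over
`X × {0,1}` admitting a hypothesis of true risk `0`, while with `D^N`-probability at
least `1/7` the learned hypothesis `A S` has true risk at least `1/8`. -/
theorem stmt_13 {X : Type*} [Fintype X] [MeasurableSpace X] [MeasurableSingletonClass X]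
    (N : ℕ) (hN : 0 < N) (hNX : 2 * N < Fintype.card X)
    (A : (Fin N → X × Bool) → (X → Bool)) :
    ∃ D : Measure (X × Bool), IsProbabilityMeasure D ∧
      (∃ f : X → Bool, D {p : X × Bool | f p.1 ≠ p.2} = 0) ∧
      (1 / 7 : ℝ≥0∞) ≤
        (Measure.pi fun _ : Fin N => D)
          {s : Fin N → X × Bool | (1 / 8 : ℝ≥0∞) ≤ D {p : X × Bool | A s p.1 ≠ p.2}} := by
  have hm : 0 < Fintype.card X := by omega
  have : Nonempty X := Fintype.card_pos_iff.1 hm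
  have hm0 : (Fintype.card X : ℝ≥0∞) ≠ 0 := by exact_mod_cast hm.ne'
  obtain ⟨f, hf⟩ := exists_le_card_errorCount hNX A
  refine ⟨graphMeasure f, isProbabilityMeasure_graphMeasure f, ⟨f, ?_⟩, ?_⟩
  · rw [graphMeasure_apply]
    simp
  · refine le_trans ?_ (le_pi_graphMeasure f _
      (Finset.univ.filter fun g => Fintype.card X ≤ 8 * errorCount A f g) fun g hg => ?_)
    · rw [← ENNReal.inv_pow, ← div_eq_mul_inv, ENNReal.le_div_iff_mul_le (by simp [hm0])
        (by simp), one_div, mul_comm, ← div_eq_mul_inv]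
      refine ENNReal.div_le_of_le_mul' ?_
      exact_mod_cast hf
    · have hg' : Fintype.card X ≤ 8 * errorCount A f g := (Finset.mem_filter.1 hg).2
      rw [Set.mem_ofPred_eq, graphMeasure_apply, mul_comm, ← div_eq_mul_inv,
        ENNReal.le_div_iff_mul_le (by simp [hm0]) (by simp), one_div, mul_comm, ← div_eq_mul_inv]
      refine ENNReal.div_le_of_le_mul' ?_
      exact_mod_cast hg'
end

section
/- Let X be a finite set, let Y be a finite label set with |Y| ≥ 2, and let N be a positive integer with N < |X|/2. Let A be any learning algorithm, i.e., any function mapping training sequences of length N in (X × Y)^N to hypotheses X → Y. Then there exists a probability distribution D over X × Y such that: (1) there exists a function f : X → Y with L_D(f) = 0, and (2) with probability at least 1/7 over the choice of an i.i.d. training sequence S of N pairs drawn from D, one has L_D(A(S)) ≥ 1/8. -/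
open MeasureTheory
open scoped ENNReal

namespace NoFreeLunch

open Finset

/-- If a prediction at `x` does not depend on the Boolean label of `x`, then it is wrong for
at least half of all Boolean labelings. -/
theorem card_le_two_mul_card_wrong {X Y : Type*} [Fintype X] [DecidableEq X] [DecidableEq Y]
    {l : Bool → Y} (hl : Function.Injective l) (x : X) (H : (X → Bool) → Y)
    (hH : ∀ g b, H (Function.update g x b) = H g) :
    Fintype.card (X → Bool) ≤ 2 * #{g : X → Bool | H g ≠ l (g x)} := by
  have hle : #{g : X → Bool | ¬ H g ≠ l (g x)} ≤ #{g : X → Bool | H g ≠ l (g x)} := by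
    refine Finset.card_le_card_of_injOn (fun g => Function.update g x (!g x)) ?_ ?_
    · intro g hg
      have hg' : H g = l (g x) := by simpa using hg
      have : H (Function.update g x (!g x)) ≠ l (Function.update g x (!g x) x) := by
        rw [hH, hg', Function.update_self]
        intro h
        have := hl h
        simp at this
      simpa using this
    · intro g _ g' _ h
      have hx : g x = g' x := by simpa using congrFun h x
      funext z
      by_cases hz : z = x
      · rw [hz, hx]
      · simpa [hz] using congrFun h z
  have hadd := Finset.card_filter_add_card_filter_not
    (s := (Finset.univ : Finset (X → Bool))) (fun g => H g ≠ l (g x))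
  rw [Finset.card_univ] at hadd
  omega

/-- Summed over all Boolean labelings, the number of mistakes made after seeing the labels of
the `N` points `t` is at least half the number of unseen points per labeling. -/
theorem card_mul_le_two_mul_sum_mistakes {X Y : Type*} [Fintype X] [DecidableEq X]
    [DecidableEq Y] {l : Bool → Y} (hl : Function.Injective l) {N : ℕ}
    (A : (Fin N → X × Y) → (X → Y)) (t : Fin N → X) :
    (Fintype.card X - N) * Fintype.card (X → Bool) ≤
      2 * ∑ g : X → Bool, #{x | A (fun i => (t i, l (g (t i)))) x ≠ l (g x)} := by
  have hswap : ∑ g : X → Bool, #{x | A (fun i => (t i, l (g (t i)))) x ≠ l (g x)} =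
      ∑ x : X, #{g : X → Bool | A (fun i => (t i, l (g (t i)))) x ≠ l (g x)} :=
    Finset.sum_card_bipartiteAbove_eq_sum_card_bipartiteBelow
      (fun (g : X → Bool) x => A (fun i => (t i, l (g (t i)))) x ≠ l (g x))
  have hcard : Fintype.card X - N ≤ #(univ.image t)ᶜ := by
    have := Finset.card_image_le (s := univ) (f := t)
    rw [Finset.card_compl]
    simp only [Finset.card_univ, Fintype.card_fin] at this
    omega
  rw [hswap, Finset.mul_sum]
  calc (Fintype.card X - N) * Fintype.card (X → Bool)
      ≤ #(univ.image t)ᶜ * Fintype.card (X → Bool) := Nat.mul_le_mul_right _ hcard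
    _ = ∑ _x ∈ (univ.image t)ᶜ, Fintype.card (X → Bool) := by simp
    _ ≤ ∑ x ∈ (univ.image t)ᶜ,
          2 * #{g : X → Bool | A (fun i => (t i, l (g (t i)))) x ≠ l (g x)} := by
        refine Finset.sum_le_sum fun x hx => card_le_two_mul_card_wrong hl x _ fun g b => ?_
        have hx' : ∀ i, t i ≠ x := by simpa using hx
        simp [Function.update_of_ne (hx' _)]
    _ ≤ _ := Finset.sum_le_sum_of_subset (Finset.subset_univ _)

/-- Some Boolean labeling forces at least a quarter of mistakes on average over all samples. -/
theorem exists_labeling_sum_mistakes {X Y : Type*} [Fintype X] [DecidableEq X]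
    [DecidableEq Y] {l : Bool → Y} (hl : Function.Injective l) {N : ℕ}
    (hN : 2 * N ≤ Fintype.card X) (A : (Fin N → X × Y) → (X → Y)) :
    ∃ g : X → Bool, Fintype.card (Fin N → X) * Fintype.card X ≤
      4 * ∑ t : Fin N → X, #{x | A (fun i => (t i, l (g (t i)))) x ≠ l (g x)} := by
  obtain ⟨g, -, hg⟩ := Finset.exists_le_of_sum_le (s := (univ : Finset (X → Bool)))
    (f := fun _ => Fintype.card (Fin N → X) * Fintype.card X)
    (g := fun g => 4 * ∑ t : Fin N → X, #{x | A (fun i => (t i, l (g (t i)))) x ≠ l (g x)})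
    Finset.univ_nonempty (by
      rw [Finset.sum_const, ← Finset.mul_sum, Finset.sum_comm]
      have h := Finset.sum_le_sum fun t (_ : t ∈ (univ : Finset (Fin N → X))) =>
        card_mul_le_two_mul_sum_mistakes hl A t
      rw [Finset.sum_const, ← Finset.mul_sum] at h
      simp only [Finset.card_univ, smul_eq_mul] at h ⊢
      have h2 : Fintype.card X ≤ 2 * (Fintype.card X - N) := by omega
      calc _ = Fintype.card X * (Fintype.card (Fin N → X) * Fintype.card (X → Bool)) := by ring
        _ ≤ 2 * (Fintype.card X - N) *
              (Fintype.card (Fin N → X) * Fintype.card (X → Bool)) :=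
            Nat.mul_le_mul_right _ h2
        _ = 2 * (Fintype.card (Fin N → X) *
              ((Fintype.card X - N) * Fintype.card (X → Bool))) := by ring
        _ ≤ _ := by omega)
  exact ⟨g, hg⟩

/-- Reverse Markov inequality for counts: if a function bounded by `m` has average at least
`m / 4`, then it is at least `m / 8` on at least a seventh of the points. -/
theorem card_le_seven_mul_card_large {T : Type*} [Fintype T] {m : ℕ} (hm : 0 < m) (e : T → ℕ)
    (he : ∀ t, e t ≤ m) (hsum : Fintype.card T * m ≤ 4 * ∑ t, e t) :
    Fintype.card T ≤ 7 * #{t | m ≤ 8 * e t} := by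
  have hpt : ∀ t, 8 * e t ≤ m + 7 * m * (if m ≤ 8 * e t then 1 else 0) := by
    intro t
    have := he t
    split_ifs <;> omega
  have h := Finset.sum_le_sum fun t (_ : t ∈ (univ : Finset T)) => hpt t
  rw [← Finset.mul_sum, Finset.sum_add_distrib, ← Finset.mul_sum, ← Finset.card_filter] at h
  simp only [Finset.sum_const, Finset.card_univ, smul_eq_mul] at h
  refine Nat.le_of_mul_le_mul_right ?_ hm
  nlinarith

/-- The uniform measure on a finite type, as normalized counting measure. -/
noncomputable def unif (X : Type*) [Fintype X] [MeasurableSpace X] : Measure X :=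
  (Fintype.card X : ℝ≥0∞)⁻¹ • Measure.count

theorem unif_apply {X : Type*} [Fintype X] [MeasurableSpace X] [MeasurableSingletonClass X]
    (s : Finset X) : unif X (s : Set X) = (#s : ℝ≥0∞) / Fintype.card X := by
  simp [unif, Measure.count_apply_finset, ENNReal.div_eq_inv_mul]

instance isProbabilityMeasure_unif {X : Type*} [Fintype X] [Nonempty X] [MeasurableSpace X]
    [MeasurableSingletonClass X] : IsProbabilityMeasure (unif X) := by
  constructor
  rw [← Finset.coe_univ, unif_apply, Finset.card_univ]
  exact ENNReal.div_self (by simp) (by simp)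

theorem pi_unif_apply {X : Type*} [Fintype X] [Nonempty X] [MeasurableSpace X]
    [MeasurableSingletonClass X] {N : ℕ} (s : Finset (Fin N → X)) :
    Measure.pi (fun _ : Fin N => unif X) (s : Set (Fin N → X)) =
      (#s : ℝ≥0∞) / Fintype.card (Fin N → X) := by
  have hs : ∀ x : X, unif X {x} = (Fintype.card X : ℝ≥0∞)⁻¹ := fun x => by
    simpa using unif_apply ({x} : Finset X)
  rw [← sum_measure_singleton]
  simp [Measure.pi_singleton, hs, ENNReal.div_eq_inv_mul, mul_comm, ENNReal.inv_pow]

end NoFreeLunch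

/-- The paper's Corollary 1: the multiclass generalization of the No-Free-Lunch theorem
with respect to the 0–1 loss. For a finite domain `X`, a finite label set `Y` with
`|Y| ≥ 2`, and any learning algorithm `A` taking training sequences of length
`N < |X|/2`, there is a probability distribution `D` over `X × Y` admitting a hypothesis
of true risk `0`, while with `D^N`-probability at least `1/7` the learned hypothesis
`A S` has true risk at least `1/8`. -/
theorem stmt_14 {X : Type*} [Fintype X] [MeasurableSpace X] [MeasurableSingletonClass X]
    {Y : Type*} [Fintype Y] [MeasurableSpace Y] [MeasurableSingletonClass Y]
    (hY : 2 ≤ Fintype.card Y)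
    (N : ℕ) (hN : 0 < N) (hNX : 2 * N < Fintype.card X)
    (A : (Fin N → X × Y) → (X → Y)) :
    ∃ D : Measure (X × Y), IsProbabilityMeasure D ∧
      (∃ f : X → Y, D {p : X × Y | f p.1 ≠ p.2} = 0) ∧
      (1 / 7 : ℝ≥0∞) ≤
        (Measure.pi fun _ : Fin N => D)
          {s : Fin N → X × Y | (1 / 8 : ℝ≥0∞) ≤ D {p : X × Y | A s p.1 ≠ p.2}} := by
  classical
  have : Nonempty X := Fintype.card_pos_iff.mp (by omega)
  obtain ⟨y₀, y₁, hy⟩ := Fintype.exists_pair_of_one_lt_card (α := Y) (by omega)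
  let l : Bool → Y := fun b => if b then y₁ else y₀
  have hl : Function.Injective l := by
    intro a b
    cases a <;> cases b <;> simp [l, hy, hy.symm]
  obtain ⟨g, hg⟩ := NoFreeLunch.exists_labeling_sum_mistakes hl hNX.le A
  have hlarge := NoFreeLunch.card_le_seven_mul_card_large (by omega) _
    (fun t => Finset.card_le_univ _) hg
  have hφ : Measurable fun x : X => (x, l (g x)) := measurable_of_finite _
  have hprob : IsProbabilityMeasure ((NoFreeLunch.unif X).map fun x => (x, l (g x))) :=
    Measure.isProbabilityMeasure_map hφ.aemeasurable
  have hrisk : ∀ h : X → Y,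
      (NoFreeLunch.unif X).map (fun x => (x, l (g x))) {p : X × Y | h p.1 ≠ p.2} =
        (Finset.card {x | h x ≠ l (g x)} : ℝ≥0∞) / Fintype.card X := by
    intro h
    rw [Measure.map_apply hφ (Set.toFinite _).measurableSet, ← NoFreeLunch.unif_apply]
    congr 1
    ext x
    simp
  refine ⟨(NoFreeLunch.unif X).map fun x => (x, l (g x)), hprob, ⟨fun x => l (g x), ?_⟩, ?_⟩
  · exact (hrisk fun x => l (g x)).trans (by simp)
  · have hT : (Fintype.card (Fin N → X) : ℝ≥0∞) ≠ 0 := by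
      exact_mod_cast Fintype.card_ne_zero
    rw [← Measure.pi_map_pi fun _ => hφ.aemeasurable,
      Measure.map_apply (measurable_of_finite _) (Set.toFinite _).measurableSet]
    simp only [hrisk]
    have hset : (fun (t : Fin N → X) i => (t i, l (g (t i)))) ⁻¹'
        {s | (1 / 8 : ℝ≥0∞) ≤
          (Finset.card {x | A s x ≠ l (g x)} : ℝ≥0∞) / Fintype.card X} =
        (({t | Fintype.card X ≤
          8 * Finset.card {x | A (fun i => (t i, l (g (t i)))) x ≠ l (g x)}} :
            Finset (Fin N → X)) : Set (Fin N → X)) := by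
      ext t
      simp only [Set.mem_preimage, Set.mem_ofPred_eq, Finset.coe_filter, Finset.mem_univ,
        true_and]
      rw [ENNReal.le_div_iff_mul_le (by simp) (by simp), one_div, mul_comm,
        ← div_eq_mul_inv, ENNReal.div_le_iff_le_mul (by simp) (by simp), mul_comm]
      norm_cast
    rw [hset, NoFreeLunch.pi_unif_apply, ENNReal.le_div_iff_mul_le (Or.inl hT) (by simp),
      one_div, mul_comm, ← div_eq_mul_inv, ENNReal.div_le_iff_le_mul (by simp) (by simp),
      mul_comm]
    exact_mod_cast hlarge
end
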